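/- Let λ ∈ k^c be nonzero and let M be a finitely generated left A-module. Then dim_k Ext^1_A(Au_λ, M) + dim_k M = dim_k { m ∈ M : u_λ m = 0 } + dim_k { m ∈ M : u_λ^{a−1} m = 0 }. -/

import Mathlib

open scoped TensorProduct

/-- The relations defining the quantum complete intersection `A^c_q`:
`x_i ^ a = 0` for all `i`, and `x_i x_j = q • x_j x_i` for `i < j`. -/
inductive QCIRel (k : Type) [Field k] (c a : ℕ) (q : k) :
    FreeAlgebra k (Fin c) → FreeAlgebra k (Fin c) → Prop
  | pow (i : Fin c) : QCIRel k c a q (FreeAlgebra.ι k i ^ a) 0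
  | comm (i j : Fin c) (hij : i < j) :
      QCIRel k c a q (FreeAlgebra.ι k i * FreeAlgebra.ι k j)
        (q • (FreeAlgebra.ι k j * FreeAlgebra.ι k i))

/-- The quantum complete intersection algebra `A^c_q = k⟨x_1,…,x_c⟩/(x_i^a, x_ix_j - q x_jx_i)`. -/
def QCI (k : Type) [Field k] (c a : ℕ) (q : k) : Type := RingQuot (QCIRel k c a q)

noncomputable instance (k : Type) [Field k] (c a : ℕ) (q : k) : Ring (QCI k c a q) :=
  inferInstanceAs (Ring (RingQuot (QCIRel k c a q)))

noncomputable instance (k : Type) [Field k] (c a : ℕ) (q : k) : Algebra k (QCI k c a q) :=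
  inferInstanceAs (Algebra k (RingQuot (QCIRel k c a q)))

namespace QCI

variable (k : Type) [Field k] (c a : ℕ) (q : k)

/-- The generators `x_i` of the quantum complete intersection. -/
noncomputable def x (i : Fin c) : QCI k c a q :=
  RingQuot.mkAlgHom k (QCIRel k c a q) (FreeAlgebra.ι k i)

/-- The element `u_λ = λ_1 x_1 + ⋯ + λ_c x_c` of `A^c_q`. -/
noncomputable def u (lam : Fin c → k) : QCI k c a q :=
  ∑ i, lam i • QCI.x k c a q i

end QCI

/-- `a' = a / gcd(a, char k)` if `char k > 0`, and `a' = a` if `char k = 0`. -/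
noncomputable def aprime (k : Type) [Field k] (a : ℕ) : ℕ :=
  if ringChar k > 0 then a / Nat.gcd a (ringChar k) else a

/-- Left multiplication by a ring element, as a `k`-linear map on a module. -/
noncomputable def smulLinearMap (k : Type) [CommRing k] {A : Type} [Ring A] [Algebra k A]
    (M : Type) [AddCommGroup M] [Module k M] [Module A M] [IsScalarTower k A M] (r : A) :
    M →ₗ[k] M where
  toFun m := r • m
  map_add' := smul_add r
  map_smul' c m := (smul_comm c r m).symm

open CategoryTheory

set_option synthInstance.maxHeartbeats 400000

section PeriodicResolution

open Limits

variable {C : Type*} [Category* C] [Abelian C] {P X : C} {φ ψ : P ⟶ P} {ε : P ⟶ X}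

/-- The projection from the periodic complex `⋯ ⟶ P ⟶ P ⟶ P` (maps alternately `φ`, `ψ`)
to `X` in degree `0` induced by `ε : P ⟶ X` with `ψ ≫ ε = 0`. -/
noncomputable def periodicComplexToSingle (hφψ : φ ≫ ψ = 0) (hψφ : ψ ≫ φ = 0)
    (hψε : ψ ≫ ε = 0) :
    HomologicalComplex.alternatingConst P hφψ hψφ
      (c := ComplexShape.down ℕ) (fun _ _ => ComplexShape.down_nat_odd_add) ⟶
      (ChainComplex.single₀ C).obj X :=
  (ChainComplex.toSingle₀Equiv _ _).symm ⟨ε, by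
    simpa [HomologicalComplex.alternatingConst] using! hψε⟩

theorem quasiIso_periodicComplexToSingle {hφψ : φ ≫ ψ = 0} {hψφ : ψ ≫ φ = 0}
    {hψε : ψ ≫ ε = 0} (h₁ : (ShortComplex.mk φ ψ hφψ).Exact) (h₂ : (ShortComplex.mk ψ φ hψφ).Exact)
    (h₀ : (ShortComplex.mk ψ ε hψε).Exact) [Epi ε] :
    QuasiIso (periodicComplexToSingle hφψ hψφ hψε) where
  quasiIsoAt m := by
    cases m with
    | zero =>
      have hε : (periodicComplexToSingle hφψ hψφ hψε).f 0 = ε :=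
        ChainComplex.toSingle₀Equiv_symm_apply_f_zero _ _
      rw [ChainComplex.quasiIsoAt₀_iff, ShortComplex.quasiIso_iff_of_zeros' _ rfl rfl rfl]
      constructor
      · exact ShortComplex.exact_of_iso (S₁ := ShortComplex.mk ψ ε hψε)
          (ShortComplex.isoMk (Iso.refl P) (Iso.refl P) (Iso.refl X)
          (by
            simp only [HomologicalComplex.shortComplexFunctor'_obj_f,
              HomologicalComplex.alternatingConst_d]
            exact (Category.id_comp ψ).trans (Category.comp_id ψ).symm)
          ((Category.id_comp _).trans (hε.trans (Category.comp_id ε).symm))) h₀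
      · have : Epi (X := P) (Y := X) ((periodicComplexToSingle hφψ hψφ hψε).f 0) := by
          rw [hε]
          infer_instance
        exact this
    | succ m =>
      rw [quasiIsoAt_iff_exactAt' (hL := ChainComplex.exactAt_succ_single_obj ..),
        HomologicalComplex.exactAt_iff' _ (m + 2) (m + 1) m (by simp) (by simp)]
      rcases Nat.even_or_odd (m + 1) with hm | hm
      · exact ShortComplex.exact_of_iso (HomologicalComplex.alternatingConstScIsoEven P hφψ hψφ _
          (by simp) (by simp) hm).symm h₂
      · exact ShortComplex.exact_of_iso (HomologicalComplex.alternatingConstScIsoOdd P hφψ hψφ _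
          (by simp) (by simp) hm).symm h₁

/-- The `2`-periodic projective resolution `⋯ ⟶ P ⟶ P ⟶ P ⟶ X` with maps alternating between
`φ` and `ψ`, augmented by `ε`. -/
noncomputable def periodicProjectiveResolution [Projective P] {hφψ : φ ≫ ψ = 0}
    {hψφ : ψ ≫ φ = 0} {hψε : ψ ≫ ε = 0} (h₁ : (ShortComplex.mk φ ψ hφψ).Exact)
    (h₂ : (ShortComplex.mk ψ φ hψφ).Exact) (h₀ : (ShortComplex.mk ψ ε hψε).Exact) [Epi ε] :
    ProjectiveResolution X where
  complex := HomologicalComplex.alternatingConst P hφψ hψφ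
    (fun _ _ => ComplexShape.down_nat_odd_add)
  projective _ := inferInstanceAs (Projective P)
  π := periodicComplexToSingle hφψ hψφ hψε
  quasiIso := quasiIso_periodicComplexToSingle h₁ h₂ h₀

end PeriodicResolution

/-- The homology of a short complex of finite-dimensional vector spaces, up to conjugating both
maps by linear isomorphisms. -/
theorem finrank_homology_add_finrank {k : Type} [Field k] (S : ShortComplex (ModuleCat.{0} k))
    {M : Type} [AddCommGroup M] [Module k M] [Module.Finite k M] (f g : M →ₗ[k] M)
    (i₁ : S.X₁ ≅ ModuleCat.of k M) (i₂ : S.X₂ ≅ ModuleCat.of k M) (i₃ : S.X₃ ≅ ModuleCat.of k M)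
    (hf : S.f ≫ i₂.hom = i₁.hom ≫ ModuleCat.ofHom f)
    (hg : S.g ≫ i₃.hom = i₂.hom ≫ ModuleCat.ofHom g) :
    Module.finrank k S.homology + Module.finrank k M =
      Module.finrank k (LinearMap.ker g) + Module.finrank k (LinearMap.ker f) := by
  let e₁ : S.X₁ ≃ₗ[k] M := i₁.toLinearEquiv
  let e₂ : S.X₂ ≃ₗ[k] M := i₂.toLinearEquiv
  let e₃ : S.X₃ ≃ₗ[k] M := i₃.toLinearEquiv
  have hf' : ∀ x, e₂ (S.f x) = f (e₁ x) := fun x => ConcreteCategory.congr_hom hf x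
  have hg' : ∀ x, e₃ (S.g x) = g (e₂ x) := fun x => ConcreteCategory.congr_hom hg x
  have : Module.Finite k S.X₁ := Module.Finite.equiv e₁.symm
  have : Module.Finite k S.X₂ := Module.Finite.equiv e₂.symm
  have h₁ : Module.finrank k S.homology =
      Module.finrank k (LinearMap.ker S.g.hom ⧸ LinearMap.range S.moduleCatToCycles) :=
    S.moduleCatHomologyIso.toLinearEquiv.finrank_eq
  have h₂ := Submodule.finrank_quotient_add_finrank (LinearMap.range S.moduleCatToCycles)
  have h₃ := LinearMap.finrank_range_add_finrank_ker S.moduleCatToCycles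
  have h₄ : Module.finrank k (LinearMap.ker S.moduleCatToCycles) =
      Module.finrank k (LinearMap.ker f) := by
    refine LinearEquiv.finrank_eq (e₁.ofSubmodules _ _ ?_)
    rw [Submodule.map_equiv_eq_comap_symm]
    ext x
    have := hf' (e₁.symm x)
    rw [e₁.apply_symm_apply] at this
    simp only [Submodule.mem_comap, LinearMap.mem_ker, ← this]
    exact Subtype.ext_iff.trans e₂.map_eq_zero_iff.symm
  have h₅ : Module.finrank k (LinearMap.ker S.g.hom) = Module.finrank k (LinearMap.ker g) := by
    refine LinearEquiv.finrank_eq (e₂.ofSubmodules _ _ ?_)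
    rw [Submodule.map_equiv_eq_comap_symm]
    ext x
    have := hg' (e₂.symm x)
    rw [e₂.apply_symm_apply] at this
    simp only [Submodule.mem_comap, LinearMap.mem_ker, ← this]
    exact e₃.map_eq_zero_iff.symm
  have h₆ := e₁.finrank_eq
  lia

section AnnihilatorPair

variable {k : Type} [Field k] {A : Type} [Ring A] [Algebra k A]

open ModuleCat in
/-- If `u` and `w` generate each other's left annihilators, then `Ext^1_A(Au, M)` is the homology
of `M ⟶ M ⟶ M`, where the maps are multiplication by `w` and then by `u`. -/
theorem finrank_ext_one_span_singleton_add_finrank {u w : A}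
    (hu : ∀ z : A, z * u = 0 ↔ z ∈ Submodule.span A {w})
    (hw : ∀ z : A, z * w = 0 ↔ z ∈ Submodule.span A {u})
    (M : Type) [AddCommGroup M] [Module k M] [Module A M] [IsScalarTower k A M]
    [Module.Finite k M] :
    Module.finrank k (((Ext k (ModuleCat A) 1).obj
          (Opposite.op (ModuleCat.of A (Submodule.span A {u})))).obj (ModuleCat.of A M))
      + Module.finrank k M
    = Module.finrank k (LinearMap.ker (smulLinearMap k M u))
      + Module.finrank k (LinearMap.ker (smulLinearMap k M w)) := by
  let φ : of A A ⟶ of A A := ofHom (LinearMap.toSpanSingleton A A u)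
  let ψ : of A A ⟶ of A A := ofHom (LinearMap.toSpanSingleton A A w)
  let ε : of A A ⟶ of A (Submodule.span A {u}) :=
    ofHom (LinearMap.toSpanSingleton A _ ⟨u, Submodule.mem_span_singleton_self u⟩)
  have hwu : w * u = 0 := (hu w).2 (Submodule.mem_span_singleton_self w)
  have huw : u * w = 0 := (hw u).2 (Submodule.mem_span_singleton_self u)
  have hφψ : φ ≫ ψ = 0 := by ext; simpa [φ, ψ] using huw
  have hψφ : ψ ≫ φ = 0 := by ext; simpa [φ, ψ] using hwu
  have hψε : ψ ≫ ε = 0 := by ext; simpa [φ, ψ, ε] using hwu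
  have h₁ : (ShortComplex.mk φ ψ hφψ).Exact := by
    rw [ShortComplex.moduleCat_exact_iff_range_eq_ker]
    ext z
    simpa [φ, ψ, Submodule.mem_span_singleton] using (hw z).symm
  have h₂ : (ShortComplex.mk ψ φ hψφ).Exact := by
    rw [ShortComplex.moduleCat_exact_iff_range_eq_ker]
    ext z
    simpa [φ, ψ, Submodule.mem_span_singleton] using (hu z).symm
  have h₀ : (ShortComplex.mk ψ ε hψε).Exact := by
    rw [ShortComplex.moduleCat_exact_iff_range_eq_ker]
    ext z
    simpa [φ, ψ, ε, Submodule.mem_span_singleton] using (hu z).symm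
  have : Epi ε := by
    rw [ModuleCat.epi_iff_surjective]
    rintro ⟨z, hz⟩
    obtain ⟨b, rfl⟩ := Submodule.mem_span_singleton.1 hz
    exact ⟨b, by ext; simp [ε]⟩
  have : Projective (of A A) := ModuleCat.projective_of_free (Module.Basis.singleton Unit A)
  let R := periodicProjectiveResolution h₁ h₂ h₀
  let K := R.complex.linearYonedaObj k (of A M)
  let : Module k (of A A ⟶ of A M) := Linear.homModule _ _
  let e : (of A A ⟶ of A M) ≃ₗ[k] M :=
    { toFun f := f.hom (1 : A)
      invFun m := ofHom (LinearMap.toSpanSingleton A M m)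
      map_add' _ _ := rfl
      map_smul' r f := by
        exact algebraMap_smul A r (f.hom (1 : A))
      left_inv f := by ext; simp
      right_inv m := by simp }
  rw [((R.isoExt 1 (of A M)).toLinearEquiv.trans
    (K.homologyIsoSc' 0 1 2 (by simp) (by simp)).toLinearEquiv).finrank_eq]
  have hd₁ : R.complex.d 1 0 = ψ := by
    simp only [R, periodicProjectiveResolution, HomologicalComplex.alternatingConst_d]
    rfl
  have hd₂ : R.complex.d 2 1 = φ := by
    simp only [R, periodicProjectiveResolution, HomologicalComplex.alternatingConst_d]
    rfl
  have he (v : A) (f : of A A ⟶ of A M) :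
      (ofHom (LinearMap.toSpanSingleton A A v) ≫ f).hom (1 : A) = v • f.hom (1 : A) := by
    rw [← map_smul]
    simp
  refine finrank_homology_add_finrank (K.sc' 0 1 2) (smulLinearMap k M w) (smulLinearMap k M u)
    e.toModuleIso e.toModuleIso e.toModuleIso ?_ ?_
  · ext f
    change (R.complex.d 1 0 ≫ f).hom (1 : A) = w • f.hom (1 : A)
    rw [hd₁]
    exact he w f
  · ext f
    change (R.complex.d 2 1 ≫ f).hom (1 : A) = u • f.hom (1 : A)
    rw [hd₂]
    exact he u f

end AnnihilatorPair

section QBinomial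

variable {k : Type} [Field k] {A : Type} [Ring A] [Algebra k A]

/-- The Gaussian binomial coefficient `[n choose m]_q`. -/
def qBinomial (q : k) : ℕ → ℕ → k
  | _, 0 => 1
  | 0, _ + 1 => 0
  | n + 1, m + 1 => qBinomial q n m + q ^ (m + 1) * qBinomial q n (m + 1)

theorem qBinomial_zero_right (q : k) (n : ℕ) : qBinomial q n 0 = 1 := by
  cases n <;> rfl

theorem qBinomial_succ_succ (q : k) (n m : ℕ) : qBinomial q (n + 1) (m + 1) =
    qBinomial q n m + q ^ (m + 1) * qBinomial q n (m + 1) := rfl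

theorem qBinomial_eq_zero_of_lt (q : k) {n m : ℕ} (h : n < m) : qBinomial q n m = 0 := by
  induction n generalizing m with
  | zero => obtain ⟨m, rfl⟩ := Nat.exists_eq_succ_of_ne_zero h.ne'; rfl
  | succ n ih =>
    obtain ⟨m, rfl⟩ := Nat.exists_eq_succ_of_ne_zero (Nat.ne_zero_of_lt h)
    rw [Nat.succ_eq_add_one, qBinomial_succ_succ, ih (by lia), ih (by lia)]
    simp

theorem qBinomial_self (q : k) (n : ℕ) : qBinomial q n n = 1 := by
  induction n with
  | zero => rfl
  | succ n ih => rw [qBinomial_succ_succ, ih, qBinomial_eq_zero_of_lt q n.lt_succ_self]; simp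

theorem one_sub_pow_mul_qBinomial_succ (q : k) {n m : ℕ} (h : m ≤ n) :
    (1 - q ^ (m + 1)) * qBinomial q n (m + 1) = (1 - q ^ (n - m)) * qBinomial q n m := by
  induction n generalizing m with
  | zero =>
    obtain rfl : m = 0 := by lia
    simp [qBinomial]
  | succ n ih =>
    cases m with
    | zero =>
      have := ih (Nat.zero_le n)
      simp only [zero_add, pow_one, Nat.sub_zero, qBinomial_zero_right, qBinomial_succ_succ]
        at this ⊢
      linear_combination q * this
    | succ m =>
      have h₁ := ih (m := m) (by lia)
      rcases (Nat.le_of_succ_le_succ h).lt_or_eq with hm | rfl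
      · have h₂ := ih (m := m + 1) hm
        obtain ⟨d, rfl⟩ := Nat.exists_eq_add_of_lt hm
        simp only [show m + d + 1 - m = d + 1 by lia, show m + d + 1 - (m + 1) = d by lia,
          show m + d + 1 + 1 - (m + 1) = d + 1 by lia] at h₁ h₂ ⊢
        rw [qBinomial_succ_succ q (m + d + 1) m, qBinomial_succ_succ q (m + d + 1) (m + 1)]
        linear_combination q ^ (m + 2) * h₂ + h₁
      · rw [qBinomial_eq_zero_of_lt q (by lia : m + 1 < m + 1 + 1)]
        simp

theorem qBinomial_eq_zero_of_isPrimitiveRoot {q : k} {n m : ℕ} (hq : IsPrimitiveRoot q n)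
    (h₀ : 0 < m) (h : m < n) : qBinomial q n m = 0 := by
  induction m with
  | zero => exact absurd h₀ (lt_irrefl 0)
  | succ m ih =>
    have h₁ := one_sub_pow_mul_qBinomial_succ q (by lia : m ≤ n)
    have h₂ : (1 - q ^ (n - m)) * qBinomial q n m = 0 := by
      rcases m.eq_zero_or_pos with rfl | hm
      · simp [hq.pow_eq_one]
      · rw [ih hm (by lia), mul_zero]
    exact (mul_eq_zero.1 (h₁.trans h₂)).resolve_left
      (sub_ne_zero.2 (hq.pow_ne_one_of_pos_of_lt h₀.ne' h).symm)

variable {q : k} {x y : A}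

theorem mul_pow_of_mul_eq_smul (h : y * x = q • (x * y)) (n : ℕ) :
    y * x ^ n = q ^ n • (x ^ n * y) := by
  induction n with
  | zero => simp
  | succ n ih =>
    rw [pow_succ, ← mul_assoc, ih, smul_mul_assoc, mul_assoc, h, mul_smul_comm, smul_smul,
      ← pow_succ, mul_assoc]

theorem pow_mul_of_mul_eq_smul (h : y * x = q • (x * y)) (n : ℕ) :
    y ^ n * x = q ^ n • (x * y ^ n) := by
  induction n with
  | zero => simp
  | succ n ih =>
    rw [pow_succ', mul_assoc, ih, mul_smul_comm, ← mul_assoc, h, smul_mul_assoc, smul_smul,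
      ← pow_succ, mul_assoc]

/-- The `q`-binomial theorem. -/
theorem add_pow_of_mul_eq_smul (h : y * x = q • (x * y)) (n : ℕ) :
    (x + y) ^ n = ∑ m ∈ Finset.range (n + 1), qBinomial q n m • (x ^ m * y ^ (n - m)) := by
  induction n with
  | zero => simp [qBinomial]
  | succ n ih =>
    have h₁ : y * (x + y) ^ n =
        ∑ m ∈ Finset.range (n + 2), (q ^ m * qBinomial q n m) • (x ^ m * y ^ (n + 1 - m)) := by
      rw [Finset.sum_range_succ, qBinomial_eq_zero_of_lt q n.lt_succ_self, ih, Finset.mul_sum]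
      simp only [mul_zero, zero_smul, add_zero]
      refine Finset.sum_congr rfl fun m hm => ?_
      rw [mul_smul_comm, ← mul_assoc, mul_pow_of_mul_eq_smul h, smul_mul_assoc, smul_smul,
        mul_assoc, ← pow_succ', mul_comm, Nat.succ_sub (Finset.mem_range_succ_iff.1 hm)]
    rw [pow_succ', add_mul, h₁, Finset.sum_range_succ', Finset.sum_range_succ' _ (n + 1), ih,
      Finset.mul_sum, ← add_assoc, ← Finset.sum_add_distrib]
    congr 1
    · refine Finset.sum_congr rfl fun m _ => ?_
      rw [qBinomial_succ_succ, add_smul, mul_smul_comm, ← mul_assoc, ← pow_succ',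
        Nat.succ_sub_succ]
    · simp [qBinomial_zero_right]

theorem add_pow_of_isPrimitiveRoot {n : ℕ} (h : y * x = q • (x * y)) (hn : 0 < n)
    (hq : IsPrimitiveRoot q n) : (x + y) ^ n = x ^ n + y ^ n := by
  rw [add_pow_of_mul_eq_smul h, Finset.sum_range_succ, Finset.sum_eq_single_of_mem 0 (by simpa)]
  · simp [qBinomial_self, qBinomial_zero_right, add_comm]
  · intro m hm hm₀
    rw [qBinomial_eq_zero_of_isPrimitiveRoot hq (Nat.pos_of_ne_zero hm₀) (Finset.mem_range.1 hm),
      zero_smul]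

theorem aprime_pos (k : Type) [Field k] {a : ℕ} (ha : 0 < a) : 0 < aprime k a := by
  unfold aprime
  split_ifs
  · exact Nat.div_pos (Nat.gcd_le_left _ ha) (Nat.gcd_pos_of_pos_left _ ha)
  · exact ha

theorem add_pow_of_isPrimitiveRoot_aprime {a : ℕ} (h : y * x = q • (x * y)) (ha : 0 < a)
    (hq : IsPrimitiveRoot q (aprime k a)) : (x + y) ^ a = x ^ a + y ^ a := by
  have ha' := aprime_pos k ha
  have hadd := add_pow_of_isPrimitiveRoot h ha' hq
  by_cases haa : aprime k a = a
  · rwa [haa] at hadd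
  have hp : 0 < ringChar k := by
    by_contra hp
    exact haa (if_neg hp)
  have hprime : (ringChar k).Prime :=
    (CharP.char_is_prime_or_zero k (ringChar k)).resolve_right hp.ne'
  have hdvd : ringChar k ∣ a := by
    by_contra hd
    refine haa ?_
    rw [aprime, if_pos hp, Nat.Coprime.gcd_eq_one, Nat.div_one]
    exact (hprime.coprime_iff_not_dvd.2 hd).symm
  have hmul : aprime k a * ringChar k = a := by
    rw [aprime, if_pos hp, Nat.gcd_eq_right hdvd, Nat.div_mul_cancel hdvd]
  have hcomm : Commute (x ^ aprime k a) (y ^ aprime k a) := by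
    have := mul_pow_of_mul_eq_smul (pow_mul_of_mul_eq_smul h (aprime k a)) (aprime k a)
    rw [hq.pow_eq_one, one_pow, one_smul] at this
    exact this.symm
  cases subsingleton_or_nontrivial A
  · exact Subsingleton.elim _ _
  have : Fact (ringChar k).Prime := ⟨hprime⟩
  have : CharP A (ringChar k) :=
    charP_of_injective_algebraMap (algebraMap k A).injective (ringChar k)
  rw [← hmul, pow_mul, hadd, add_pow_char_of_commute _ hcomm, pow_mul, pow_mul]

end QBinomial

namespace QCI

section Relations

variable {k : Type} [Field k] {c a : ℕ} {q : k}

theorem x_pow_eq_zero (i : Fin c) : x k c a q i ^ a = 0 := by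
  have := RingQuot.mkAlgHom_rel k (QCIRel.pow (k := k) (q := q) (a := a) i)
  rwa [map_pow, map_zero] at this

theorem x_mul_x_of_lt {i j : Fin c} (h : i < j) :
    x k c a q i * x k c a q j = q • (x k c a q j * x k c a q i) := by
  have := RingQuot.mkAlgHom_rel k (QCIRel.comm (k := k) (q := q) (a := a) i j h)
  rwa [map_mul, map_smul, map_mul] at this

theorem exists_x_mul_x (hq : q ≠ 0) (i j : Fin c) :
    ∃ r : k, x k c a q i * x k c a q j = r • (x k c a q j * x k c a q i) := by
  rcases lt_trichotomy i j with h | rfl | h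
  · exact ⟨q, x_mul_x_of_lt h⟩
  · exact ⟨1, (one_smul _ _).symm⟩
  · refine ⟨q⁻¹, ?_⟩
    rw [x_mul_x_of_lt h, smul_smul, inv_mul_cancel₀ hq, one_smul]

theorem sum_smul_x_pow (ha : 0 < a) (hq : IsPrimitiveRoot q (aprime k a)) (lam : Fin c → k)
    (s : Finset (Fin c)) : (∑ i ∈ s, lam i • x k c a q i) ^ a = 0 := by
  induction s using Finset.induction_on_max with
  | empty => simp [ha.ne']
  | insert m s hs ih =>
    have h : (∑ i ∈ s, lam i • x k c a q i) * (lam m • x k c a q m) =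
        q • ((lam m • x k c a q m) * ∑ i ∈ s, lam i • x k c a q i) := by
      rw [Finset.sum_mul, Finset.mul_sum, Finset.smul_sum]
      refine Finset.sum_congr rfl fun i hi => ?_
      rw [smul_mul_smul_comm, smul_mul_smul_comm, x_mul_x_of_lt (hs i hi), smul_smul, smul_smul,
        mul_comm (lam i), mul_comm q]
    rw [Finset.sum_insert fun hm => lt_irrefl m (hs m hm),
      add_pow_of_isPrimitiveRoot_aprime h ha hq, ih, smul_pow, x_pow_eq_zero, smul_zero, add_zero]

theorem u_pow_eq_zero (ha : 0 < a) (hq : IsPrimitiveRoot q (aprime k a)) (lam : Fin c → k) :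
    u k c a q lam ^ a = 0 :=
  sum_smul_x_pow ha hq lam Finset.univ

theorem submodule_eq_top (N : Submodule k (QCI k c a q)) (h₁ : 1 ∈ N)
    (hx : ∀ i, ∀ z ∈ N, x k c a q i * z ∈ N) : N = ⊤ := by
  refine Submodule.eq_top_iff'.2 fun z => ?_
  let mk : FreeAlgebra k (Fin c) →ₐ[k] QCI k c a q := RingQuot.mkAlgHom k (QCIRel k c a q)
  obtain ⟨z, rfl⟩ : ∃ y, mk y = z := RingQuot.mkAlgHom_surjective k (QCIRel k c a q) z
  suffices h : ∀ n ∈ N, mk z * n ∈ N by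
    simpa using h 1 h₁
  induction z using FreeAlgebra.induction with
  | grade0 r =>
    intro n hn
    rw [AlgHom.commutes]
    exact (Algebra.smul_def r n) ▸ N.smul_mem r hn
  | grade1 i => exact hx i
  | mul y z hy hz =>
    intro n hn
    rw [map_mul]
    exact (mul_assoc _ _ n).symm ▸ hy _ (hz n hn)
  | add y z hy hz =>
    intro n hn
    rw [map_add]
    exact (add_mul _ _ n).symm ▸ N.add_mem (hy n hn) (hz n hn)

end Relations

section Monomial

variable (k : Type) [Field k] (c a : ℕ) (q : k)

/-- The ordered monomial `x_1 ^ α_1 ⋯ x_c ^ α_c`. -/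
noncomputable def monomial (α : Fin c → ℕ) : QCI k c a q :=
  ((List.finRange c).map fun j => x k c a q j ^ α j).prod

variable {k c a q}

theorem monomial_zero : monomial k c a q 0 = 1 := by
  simp [monomial]

theorem monomial_eq_zero {α : Fin c → ℕ} {j : Fin c} (h : a ≤ α j) :
    monomial k c a q α = 0 :=
  List.prod_eq_zero (List.mem_map.2
    ⟨j, List.mem_finRange j, pow_eq_zero_of_le h (x_pow_eq_zero j)⟩)

theorem exists_x_mul_list_prod (hq : q ≠ 0) (i : Fin c) (α : Fin c → ℕ) (l : List (Fin c)) :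
    ∃ r : k, x k c a q i * (l.map fun j => x k c a q j ^ α j).prod =
      r • ((l.map fun j => x k c a q j ^ α j).prod * x k c a q i) := by
  induction l with
  | nil => exact ⟨1, by simp⟩
  | cons j l ih =>
    obtain ⟨r, hr⟩ := ih
    obtain ⟨s, hs⟩ := exists_x_mul_x (a := a) hq i j
    refine ⟨s ^ α j * r, ?_⟩
    rw [List.map_cons, List.prod_cons, ← mul_assoc, mul_pow_of_mul_eq_smul hs, smul_mul_assoc,
      mul_assoc, hr, mul_smul_comm, smul_smul, mul_assoc]

theorem exists_list_prod_mul_x (hq : q ≠ 0) (i : Fin c) (α : Fin c → ℕ) (l : List (Fin c)) :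
    ∃ r : k, (l.map fun j => x k c a q j ^ α j).prod * x k c a q i =
      r • (x k c a q i * (l.map fun j => x k c a q j ^ α j).prod) := by
  induction l with
  | nil => exact ⟨1, by simp⟩
  | cons j l ih =>
    obtain ⟨r, hr⟩ := ih
    obtain ⟨s, hs⟩ := exists_x_mul_x (a := a) hq j i
    refine ⟨r * s ^ α j, ?_⟩
    rw [List.map_cons, List.prod_cons, mul_assoc, hr, mul_smul_comm, ← mul_assoc,
      pow_mul_of_mul_eq_smul hs, smul_mul_assoc, smul_smul, mul_assoc]

theorem exists_x_mul_list_prod_of_mem (hq : q ≠ 0) {i : Fin c} (α : Fin c → ℕ)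
    {l : List (Fin c)} (hl : l.Nodup) (hi : i ∈ l) :
    ∃ r : k, x k c a q i * (l.map fun j => x k c a q j ^ α j).prod =
      r • (l.map fun j => x k c a q j ^ (α + Pi.single i 1 : Fin c → ℕ) j).prod := by
  induction l with
  | nil => simp at hi
  | cons j l ih =>
    obtain ⟨hj, hl⟩ := List.nodup_cons.1 hl
    rcases eq_or_ne i j with rfl | hij
    · refine ⟨1, ?_⟩
      have : (l.map fun j => x k c a q j ^ (α + Pi.single i 1 : Fin c → ℕ) j) =
          l.map fun j => x k c a q j ^ α j := by
        refine List.map_congr_left fun j hjl => ?_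
        have hji : j ≠ i := fun h => hj (h ▸ hjl)
        simp [hji]
      rw [List.map_cons, List.map_cons, this]
      simp [pow_succ', mul_assoc]
    · obtain ⟨r, hr⟩ := ih hl ((List.mem_cons.1 hi).resolve_left hij)
      obtain ⟨s, hs⟩ := exists_x_mul_x (a := a) hq i j
      refine ⟨s ^ α j * r, ?_⟩
      rw [List.map_cons, List.prod_cons, ← mul_assoc, mul_pow_of_mul_eq_smul hs, smul_mul_assoc,
        mul_assoc, hr, mul_smul_comm, smul_smul, List.map_cons, List.prod_cons]
      simp [hij.symm]

theorem exists_x_mul_monomial (hq : q ≠ 0) (i : Fin c) (α : Fin c → ℕ) :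
    ∃ r : k, x k c a q i * monomial k c a q α = r • monomial k c a q (α + Pi.single i 1) :=
  exists_x_mul_list_prod_of_mem hq α (List.nodup_finRange c) (List.mem_finRange i)

theorem span_monomial_eq_top (hq : q ≠ 0) :
    Submodule.span k (monomial k c a q '' {α | ∀ j, α j < a}) = ⊤ := by
  have hmem (α : Fin c → ℕ) : monomial k c a q α ∈
      Submodule.span k (monomial k c a q '' {α | ∀ j, α j < a}) := by
    by_cases h : ∀ j, α j < a
    · exact Submodule.subset_span ⟨α, h, rfl⟩
    · obtain ⟨j, hj⟩ := not_forall.1 h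
      rw [monomial_eq_zero (not_lt.1 hj)]
      exact Submodule.zero_mem _
  refine submodule_eq_top _ (monomial_zero (k := k) (q := q) ▸ hmem 0) fun i z hz => ?_
  induction hz using Submodule.span_induction with
  | mem z hz =>
    obtain ⟨α, -, rfl⟩ := hz
    obtain ⟨r, hr⟩ := exists_x_mul_monomial (a := a) hq i α
    exact hr ▸ Submodule.smul_mem _ r (hmem _)
  | zero => simp
  | add y z _ _ hy hz => exact mul_add (x k c a q i) y z ▸ Submodule.add_mem _ hy hz
  | smul r z _ hz => exact mul_smul_comm r (x k c a q i) z ▸ Submodule.smul_mem _ r hz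

theorem finite_of_ne_zero (hq : q ≠ 0) : Module.Finite k (QCI k c a q) := by
  refine ⟨Submodule.fg_def.2 ⟨_, Set.Finite.image _ ?_, span_monomial_eq_top hq⟩⟩
  refine (Set.Finite.pi' fun _ : Fin c => Set.finite_Iio a).subset fun α hα => hα

variable (k c a q) in
/-- The span of the monomials not involving `x_i`. -/
noncomputable def spanMonomialWithout (i : Fin c) : Submodule k (QCI k c a q) :=
  Submodule.span k (monomial k c a q '' {α | α i = 0})

theorem finrank_spanMonomialWithout_le (i : Fin c) :
    Module.finrank k (spanMonomialWithout k c a q i) ≤ a ^ (c - 1) := by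
  let b (β : {j // j ≠ i} → Fin a) : QCI k c a q :=
    monomial k c a q fun j => if h : j ≠ i then β ⟨j, h⟩ else 0
  have hle : spanMonomialWithout k c a q i ≤ Submodule.span k (Set.range b) := by
    refine Submodule.span_le.2 ?_
    rintro _ ⟨α, hα, rfl⟩
    by_cases h : ∀ j, α j < a
    · refine Submodule.subset_span ⟨fun j => ⟨α j, h j⟩, congrArg (monomial k c a q) (funext fun j => ?_)⟩
      split_ifs with hj
      · rfl
      · rw [not_not.1 hj, hα]
    · obtain ⟨j, hj⟩ := not_forall.1 h
      rw [monomial_eq_zero (not_lt.1 hj)]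
      exact Submodule.zero_mem _
  have : Module.Finite k (Submodule.span k (Set.range b)) :=
    Module.Finite.span_of_finite k (Set.finite_range b)
  refine (Submodule.finrank_mono hle).trans ((finrank_range_le_card b).trans ?_)
  simp

theorem spanMonomialWithout_sup_range_mulRight (hq : q ≠ 0) {lam : Fin c → k} {i : Fin c}
    (hi : lam i ≠ 0) :
    spanMonomialWithout k c a q i ⊔ LinearMap.range (LinearMap.mulRight k (u k c a q lam)) = ⊤ := by
  set B := spanMonomialWithout k c a q i
  set R := LinearMap.range (LinearMap.mulRight k (u k c a q lam))
  have hB (α : Fin c → ℕ) (hα : α i = 0) : monomial k c a q α ∈ B :=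
    Submodule.subset_span ⟨α, hα, rfl⟩
  have hne (j : Fin c) (hj : j ≠ i) (α : Fin c → ℕ) (hα : α i = 0) :
      x k c a q j * monomial k c a q α ∈ B := by
    obtain ⟨r, hr⟩ := exists_x_mul_monomial (a := a) hq j α
    exact hr ▸ Submodule.smul_mem _ r (hB _ (by simp [hα, hj.symm]))
  have hright (α : Fin c → ℕ) (hα : α i = 0) :
      monomial k c a q α * x k c a q i ∈ B ⊔ R := by
    have hu : monomial k c a q α * u k c a q lam =
        lam i • (monomial k c a q α * x k c a q i) +
          ∑ j ∈ Finset.univ.erase i, lam j • (monomial k c a q α * x k c a q j) := by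
      rw [u, Finset.mul_sum, ← Finset.add_sum_erase _ _ (Finset.mem_univ i)]
      simp only [mul_smul_comm]
    have hmem : lam i • (monomial k c a q α * x k c a q i) ∈ B ⊔ R := by
      rw [eq_sub_of_add_eq hu.symm]
      refine Submodule.sub_mem _ (Submodule.mem_sup_right ⟨_, rfl⟩) (Submodule.mem_sup_left ?_)
      refine Submodule.sum_mem _ fun j hj => Submodule.smul_mem _ _ ?_
      obtain ⟨r, hr⟩ := exists_list_prod_mul_x (a := a) hq j α (List.finRange c)
      rw [monomial, hr]
      exact Submodule.smul_mem _ r (hne j (Finset.ne_of_mem_erase hj) α hα)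
    simpa [smul_smul, hi] using Submodule.smul_mem _ (lam i)⁻¹ hmem
  have hleft (j : Fin c) (b : QCI k c a q) (hb : b ∈ B) : x k c a q j * b ∈ B ⊔ R := by
    induction hb using Submodule.span_induction with
    | mem z hz =>
      obtain ⟨α, hα, rfl⟩ := hz
      rcases eq_or_ne j i with rfl | hj
      · obtain ⟨r, hr⟩ := exists_x_mul_list_prod (a := a) hq j α (List.finRange c)
        rw [monomial, hr]
        exact Submodule.smul_mem _ r (hright α hα)
      · exact Submodule.mem_sup_left (hne j hj α hα)
    | zero => simp
    | add y z _ _ hy hz => exact mul_add (x k c a q j) y z ▸ Submodule.add_mem _ hy hz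
    | smul r z _ hz => exact mul_smul_comm r (x k c a q j) z ▸ Submodule.smul_mem _ r hz
  refine submodule_eq_top _ (Submodule.mem_sup_left (monomial_zero (k := k) (q := q) ▸ hB 0 rfl))
    fun j z hz => ?_
  obtain ⟨b, hb, _, ⟨y, rfl⟩, rfl⟩ := Submodule.mem_sup.1 hz
  rw [mul_add]
  exact Submodule.add_mem _ (hleft j b hb)
    (Submodule.mem_sup_right ⟨x k c a q j * y, by simp [mul_assoc]⟩)

end Monomial

section Regular

variable (k : Type) [Field k] (c a : ℕ) (q : k)

/-- The action of `x_i` on the space with basis the descending monomials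
`x_c ^ α_c ⋯ x_1 ^ α_1`. -/
noncomputable def monomialShift (i : Fin c) : Module.End k ((Fin c → ℕ) →₀ k) :=
  Finsupp.linearCombination k fun α =>
    if α i + 1 < a then Finsupp.single (α + Pi.single i 1) (q ^ ∑ l ∈ Finset.Ioi i, α l) else 0

variable {c a}

theorem monomialShift_single (i : Fin c) (α : Fin c → ℕ) :
    monomialShift k c a q i (Finsupp.single α 1) =
      if α i + 1 < a then q ^ (∑ l ∈ Finset.Ioi i, α l) • Finsupp.single (α + Pi.single i 1) 1
      else 0 := by
  simp [monomialShift]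

theorem monomialShift_pow_single (i : Fin c) (α : Fin c → ℕ) (n : ℕ) :
    (monomialShift k c a q i ^ (n + 1)) (Finsupp.single α 1) =
      if α i + n + 1 < a then
        (q ^ (∑ l ∈ Finset.Ioi i, α l)) ^ (n + 1) • Finsupp.single (α + Pi.single i (n + 1)) 1
      else 0 := by
  induction n with
  | zero => simp [monomialShift_single]
  | succ n ih =>
    rw [pow_succ', Module.End.mul_apply, ih]
    split_ifs with h₁ h₂ h₂
    · have hs : ∑ l ∈ Finset.Ioi i, (α + Pi.single i (n + 1) : Fin c → ℕ) l =
          ∑ l ∈ Finset.Ioi i, α l :=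
        Finset.sum_congr rfl fun l hl => by simp [(Finset.mem_Ioi.1 hl).ne']
      rw [map_smul, monomialShift_single, if_pos (by simpa [add_assoc] using h₂), hs, smul_smul,
        ← pow_succ, add_assoc α, ← Pi.single_add]
    · rw [map_smul, monomialShift_single, if_neg (by simpa [add_assoc] using h₂), smul_zero]
    · lia
    · exact map_zero _

theorem monomialShift_pow_eq_zero (ha : 0 < a) (i : Fin c) : monomialShift k c a q i ^ a = 0 := by
  obtain ⟨n, rfl⟩ := Nat.exists_eq_succ_of_ne_zero ha.ne'
  refine Finsupp.lhom_ext' fun α => LinearMap.ext_ring ?_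
  exact (monomialShift_pow_single k q i α n).trans (if_neg (by lia))

theorem monomialShift_mul {i j : Fin c} (h : i < j) :
    monomialShift k c a q i * monomialShift k c a q j =
      q • (monomialShift k c a q j * monomialShift k c a q i) := by
  refine Finsupp.lhom_ext' fun α => LinearMap.ext_ring ?_
  simp only [LinearMap.comp_apply, Finsupp.lsingle_apply, LinearMap.smul_apply,
    Module.End.mul_apply, monomialShift_single]
  have h₁ : ∑ l ∈ Finset.Ioi i, (α + Pi.single j 1 : Fin c → ℕ) l =
      ∑ l ∈ Finset.Ioi i, α l + 1 := by
    simp [Finset.sum_add_distrib, h]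
  have h₂ : ∑ l ∈ Finset.Ioi j, (α + Pi.single i 1 : Fin c → ℕ) l = ∑ l ∈ Finset.Ioi j, α l :=
    Finset.sum_congr rfl fun l hl => by simp [(h.trans (Finset.mem_Ioi.1 hl)).ne']
  split_ifs with hj hi hi
  · rw [map_smul, map_smul, monomialShift_single, monomialShift_single,
      if_pos (by simpa [h.ne] using hi), if_pos (by simpa [h.ne'] using hj), h₁, h₂, smul_smul,
      smul_smul, smul_smul, add_right_comm α]
    congr 1
    ring
  · rw [map_smul, monomialShift_single, if_neg (by simpa [h.ne] using hi)]
    simp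
  · rw [map_smul, monomialShift_single, if_neg (by simpa [h.ne'] using hj)]
    simp
  · simp

/-- The representation of `A^c_q` on the space with basis the descending monomials. -/
noncomputable def monomialRep (ha : 0 < a) :
    QCI k c a q →ₐ[k] Module.End k ((Fin c → ℕ) →₀ k) :=
  RingQuot.liftAlgHom k ⟨FreeAlgebra.lift k (monomialShift k c a q), fun _ _ h => by
    cases h with
    | pow i => simp [monomialShift_pow_eq_zero k q ha]
    | comm i j hij => simp [monomialShift_mul k q hij]⟩

theorem monomialRep_x (ha : 0 < a) (i : Fin c) :
    monomialRep k q ha (x k c a q i) = monomialShift k c a q i := by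
  exact (RingQuot.liftAlgHom_mkAlgHom_apply ..).trans (FreeAlgebra.lift_ι_apply ..)

variable {k q}

theorem single_mem_range_monomialRep (ha : 0 < a) (hq : q ≠ 0) (α : Fin c → ℕ)
    (hα : ∀ j, α j < a) :
    ∃ z : QCI k c a q, monomialRep k q ha z (Finsupp.single 0 1) = Finsupp.single α 1 := by
  induction hn : ∑ j, α j generalizing α with
  | zero =>
    obtain rfl : α = 0 := by
      funext j
      exact Finset.sum_eq_zero_iff.1 hn j (Finset.mem_univ j)
    exact ⟨1, by simp⟩
  | succ n ih =>
    obtain ⟨i, -, hi⟩ := Finset.exists_ne_zero_of_sum_ne_zero (hn.trans_ne n.succ_ne_zero)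
    let β : Fin c → ℕ := Function.update α i (α i - 1)
    have hβ : β + Pi.single i 1 = α := by
      funext j
      rcases eq_or_ne j i with rfl | hj
      · simp [β]; lia
      · simp [β, hj]
    have hβi : β i + 1 < a := by
      have := congrFun hβ i
      simp only [Pi.add_apply, Pi.single_eq_same] at this
      exact this ▸ hα i
    obtain ⟨z, hz⟩ := ih β (fun j => lt_of_le_of_lt (by simp [← hβ]) (hα j)) (by
      rw [← hβ] at hn
      simpa [Finset.sum_add_distrib] using hn)
    refine ⟨(q ^ ∑ l ∈ Finset.Ioi i, β l)⁻¹ • (x k c a q i * z), ?_⟩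
    rw [map_smul, LinearMap.smul_apply, map_mul, Module.End.mul_apply, hz, monomialRep_x,
      monomialShift_single, if_pos hβi, hβ, smul_smul, inv_mul_cancel₀ (pow_ne_zero _ hq), one_smul]

theorem pow_le_finrank (ha : 0 < a) (hq : q ≠ 0) : a ^ c ≤ Module.finrank k (QCI k c a q) := by
  have := finite_of_ne_zero (c := c) (a := a) hq
  choose z hz using fun α : Fin c → Fin a =>
    single_mem_range_monomialRep ha hq (fun j => (α j : ℕ)) fun j => (α j).2
  have hli : LinearIndependent k z := by
    refine LinearIndependent.of_comp
      ((LinearMap.applyₗ (Finsupp.single 0 1)).comp (monomialRep k q ha).toLinearMap) ?_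
    have hinj : Function.Injective fun (α : Fin c → Fin a) (j : Fin c) => (α j : ℕ) :=
      fun α β h => funext fun j => Fin.ext (congrFun h j)
    convert (Finsupp.linearIndependent_single_one k (Fin c → ℕ)).comp _ hinj using 1
    exact funext hz
  simpa using hli.fintype_card_le_finrank

end Regular

section Annihilator

variable {k : Type} [Field k] {c a : ℕ} {q : k} {lam : Fin c → k}

theorem finrank_range_mulRight_u_pow_le (hq : q ≠ 0) (hlam : lam ≠ 0) (t s : ℕ) :
    Module.finrank k (LinearMap.range (LinearMap.mulRight k (u k c a q lam ^ t))) ≤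
      Module.finrank k (LinearMap.range (LinearMap.mulRight k (u k c a q lam ^ (t + s)))) +
        s * a ^ (c - 1) := by
  have := finite_of_ne_zero (c := c) (a := a) hq
  obtain ⟨i, hi⟩ := Function.ne_iff.1 hlam
  induction s with
  | zero => simp
  | succ s ih =>
    have htop := congrArg (Submodule.map (LinearMap.mulRight k (u k c a q lam ^ (t + s))))
      (spanMonomialWithout_sup_range_mulRight (a := a) hq hi)
    rw [Submodule.map_sup, ← LinearMap.range_comp, Submodule.map_top, ← LinearMap.mulRight_mul,
      ← pow_succ'] at htop
    have h₁ := Submodule.finrank_add_le_finrank_add_finrank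
      ((spanMonomialWithout k c a q i).map (LinearMap.mulRight k (u k c a q lam ^ (t + s))))
      (LinearMap.range (LinearMap.mulRight k (u k c a q lam ^ (t + s + 1))))
    rw [htop] at h₁
    have h₂ := Submodule.finrank_map_le (LinearMap.mulRight k (u k c a q lam ^ (t + s)))
      (spanMonomialWithout k c a q i)
    have h₃ := finrank_spanMonomialWithout_le (k := k) (a := a) (q := q) i
    rw [← add_assoc, add_mul, one_mul]
    lia

theorem mul_u_pow_eq_zero_iff (hc : 0 < c) (ha : 0 < a) (hq : IsPrimitiveRoot q (aprime k a))
    (hlam : lam ≠ 0) {s t : ℕ} (hst : s + t = a) (z : QCI k c a q) :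
    z * u k c a q lam ^ s = 0 ↔ z ∈ Submodule.span (QCI k c a q) {u k c a q lam ^ t} := by
  have hq₀ : q ≠ 0 := hq.ne_zero (aprime_pos k ha).ne'
  have := finite_of_ne_zero (c := c) (a := a) hq₀
  have hle : LinearMap.range (LinearMap.mulRight k (u k c a q lam ^ t)) ≤
      LinearMap.ker (LinearMap.mulRight k (u k c a q lam ^ s)) := by
    rintro _ ⟨y, rfl⟩
    simp [mul_assoc, ← pow_add, add_comm t, hst, u_pow_eq_zero ha hq]
  have heq := Submodule.eq_of_le_of_finrank_le hle (by
    have h₀ := LinearMap.finrank_range_add_finrank_ker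
      (LinearMap.mulRight k (u k c a q lam ^ s))
    have h₁ := finrank_range_mulRight_u_pow_le (a := a) hq₀ hlam 0 s
    have h₂ := finrank_range_mulRight_u_pow_le (a := a) hq₀ hlam 0 t
    have h₃ := pow_le_finrank (c := c) ha hq₀
    have h₄ := finrank_range_mulRight_u_pow_le (a := a) hq₀ hlam 0 a
    have h₅ : a ^ c = s * a ^ (c - 1) + t * a ^ (c - 1) := by
      rw [← add_mul, hst, mul_pow_sub_one hc.ne']
    rw [zero_add, u_pow_eq_zero ha hq, LinearMap.mulRight_zero_eq_zero, LinearMap.range_zero,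
      finrank_bot, zero_add, mul_pow_sub_one hc.ne'] at h₄
    rw [pow_zero, LinearMap.mulRight_one, LinearMap.range_id, finrank_top, zero_add] at h₁ h₂
    rw [pow_zero, LinearMap.mulRight_one, LinearMap.range_id, finrank_top] at h₄
    lia)
  have := SetLike.ext_iff.1 heq z
  rw [LinearMap.mem_ker, LinearMap.mulRight_apply] at this
  rw [← this, Submodule.mem_span_singleton]
  rfl

end Annihilator

end QCI

/-- For nonzero `λ ∈ k^c` and a finitely generated left `A`-module `M`,
`dim_k Ext^1_A(Au_λ, M) + dim_k M = dim_k {m : u_λ m = 0} + dim_k {m : u_λ^{a-1} m = 0}`. -/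
theorem finrank_ext_one_add_finrank (k : Type) [Field k] [IsAlgClosed k]
    (a c : ℕ) (ha : 2 ≤ a) (hc : 1 ≤ c) (q : k) (hq : IsPrimitiveRoot q (aprime k a))
    (lam : Fin c → k) (hlam : lam ≠ 0)
    (M : Type) [AddCommGroup M] [Module k M] [Module (QCI k c a q) M]
    [IsScalarTower k (QCI k c a q) M] [Module.Finite (QCI k c a q) M] :
    Module.finrank k (((Ext k (ModuleCat (QCI k c a q)) 1).obj
          (Opposite.op (ModuleCat.of (QCI k c a q)
            (Submodule.span (QCI k c a q) {QCI.u k c a q lam})))).obj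
        (ModuleCat.of (QCI k c a q) M))
      + Module.finrank k M
    = Module.finrank k (LinearMap.ker (smulLinearMap k M (QCI.u k c a q lam)))
      + Module.finrank k (LinearMap.ker (smulLinearMap k M (QCI.u k c a q lam ^ (a - 1)))) := by
  have hq₀ : q ≠ 0 := hq.ne_zero (aprime_pos k (by lia)).ne'
  have := QCI.finite_of_ne_zero (c := c) (a := a) hq₀
  have : Module.Finite k M := Module.Finite.trans (QCI k c a q) M
  exact finrank_ext_one_span_singleton_add_finrank
    (fun z => by
      simpa using QCI.mul_u_pow_eq_zero_iff hc (by lia) hq hlam (s := 1) (t := a - 1) (by lia) z)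
    (fun z => by
      simpa using QCI.mul_u_pow_eq_zero_iff hc (by lia) hq hlam (s := a - 1) (t := 1) (by lia) z)
    M
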